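/- Let (X, d) be a nonempty compact metric space with diameter D_X > 0, let (xₙ) be a dense sequence in X, let q > 1, c_φ = √(q²−1)/q, N ≥ 2. Define φ(x) = (c_φ·d(x, xₙ)/qⁿ)_{n∈ℕ} ∈ ℓ², φ_t(x) = (c_φ·d(x, xₙ)/qⁿ)_{n=0}^{N−1} ∈ ℝ^N, and B_t : ℝ^N → ℓ² the padding map B_t(u) = (u₀, …, u_{N−1}, 0, 0, …). Let μ be a finite Borel measure on [0, ∞), K(t) = ∫₀^∞ e^{−st} dμ(s), and C = max_{t ∈ [0, 4D_X²]} |K'(t)|. Then for every m ∈ ℕ, all z₁, …, z_m ∈ X and all reals a₁, …, a_m: sup_{x ∈ X} |∑_{i=1}^m aᵢ (K(‖φ(zᵢ) − φ(x)‖²_{ℓ²}) − K(‖φ(zᵢ) − B_t(φ_t(x))‖²_{ℓ²}))| ≤ q^{−N}·D_X·√(2C) · √(∑_{i,j} aᵢ aⱼ K(‖φ(zᵢ) − φ(zⱼ)‖²_{ℓ²})). -/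

import Mathlib

open MeasureTheory

theorem sum_mul_inner_pow_nonneg {ι E : Type*} [Fintype ι] [NormedAddCommGroup E]
    [InnerProductSpace ℝ E] (u : ι → E) (c : ι → ℝ) (n : ℕ) :
    0 ≤ ∑ i, ∑ j, c i * c j * inner ℝ (u i) (u j) ^ n := by
  have hpsd : (Matrix.of fun i j => inner ℝ (u i) (u j) ^ n : Matrix ι ι ℝ).PosSemidef := by
    induction n with
    | zero =>
      have h : (Matrix.of fun i j => inner ℝ (u i) (u j) ^ 0 : Matrix ι ι ℝ) =
          Matrix.gram ℝ fun _ => (1 : ℝ) := by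
        ext i j
        simp
      rw [h]
      exact Matrix.posSemidef_gram ℝ _
    | succ n ih =>
      have h : (Matrix.of fun i j => inner ℝ (u i) (u j) ^ (n + 1) : Matrix ι ι ℝ) =
          (Matrix.of fun i j => inner ℝ (u i) (u j) ^ n).hadamard (Matrix.gram ℝ u) := by
        ext i j
        simp [pow_succ]
      rw [h]
      exact ih.hadamard (Matrix.posSemidef_gram ℝ u)
  have h := hpsd.dotProduct_mulVec_nonneg c
  simp only [dotProduct, Matrix.mulVec, Finset.mul_sum] at h
  refine h.trans_eq (Finset.sum_congr rfl fun i _ => Finset.sum_congr rfl fun j _ => ?_)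
  simp only [star_trivial, Matrix.of_apply]
  ring

theorem sum_mul_exp_mul_inner_nonneg {ι E : Type*} [Fintype ι] [NormedAddCommGroup E]
    [InnerProductSpace ℝ E] (u : ι → E) (c : ι → ℝ) {a : ℝ} (ha : 0 ≤ a) :
    0 ≤ ∑ i, ∑ j, c i * c j * Real.exp (a * inner ℝ (u i) (u j)) := by
  have hs : HasSum (fun n : ℕ => ∑ i, ∑ j, c i * c j *
      ((a * inner ℝ (u i) (u j)) ^ n / n.factorial))
      (∑ i, ∑ j, c i * c j * Real.exp (a * inner ℝ (u i) (u j))) := by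
    refine hasSum_sum fun i _ => hasSum_sum fun j _ => HasSum.mul_left _ ?_
    rw [Real.exp_eq_exp_ℝ]
    exact NormedSpace.expSeries_div_hasSum_exp _
  refine hs.nonneg fun n => ?_
  have h := mul_nonneg (div_nonneg (pow_nonneg ha n) (Nat.cast_nonneg n.factorial))
    (sum_mul_inner_pow_nonneg u c n)
  simp only [Finset.mul_sum] at h
  refine h.trans_eq (Finset.sum_congr rfl fun i _ => Finset.sum_congr rfl fun j _ => ?_)
  rw [mul_pow]
  ring

/-- The Gaussian kernel on a real inner product space is positive semidefinite. -/
theorem sum_mul_exp_neg_mul_norm_sub_sq_nonneg {ι E : Type*} [Fintype ι] [NormedAddCommGroup E]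
    [InnerProductSpace ℝ E] (u : ι → E) (c : ι → ℝ) {s : ℝ} (hs : 0 ≤ s) :
    0 ≤ ∑ i, ∑ j, c i * c j * Real.exp (-(s * ‖u i - u j‖ ^ 2)) := by
  have h := sum_mul_exp_mul_inner_nonneg u (fun i => c i * Real.exp (-(s * ‖u i‖ ^ 2)))
    (mul_nonneg zero_le_two hs)
  refine h.trans_eq (Finset.sum_congr rfl fun i _ => Finset.sum_congr rfl fun j _ => ?_)
  rw [norm_sub_sq_real, show -(s * (‖u i‖ ^ 2 - 2 * inner ℝ (u i) (u j) + ‖u j‖ ^ 2)) =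
    -(s * ‖u i‖ ^ 2) + -(s * ‖u j‖ ^ 2) + 2 * s * inner ℝ (u i) (u j) by ring,
    Real.exp_add, Real.exp_add]
  ring

section Laplace

variable {μ : Measure ℝ} [IsFiniteMeasure μ]

theorem norm_exp_neg_mul_le_one {s t : ℝ} (hs : 0 ≤ s) (ht : 0 ≤ t) :
    ‖Real.exp (-(s * t))‖ ≤ 1 := by
  rw [Real.norm_eq_abs, Real.abs_exp, Real.exp_le_one_iff]
  exact neg_nonpos.2 (mul_nonneg hs ht)

theorem integrable_exp_neg_mul {t : ℝ} (ht : 0 ≤ t) :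
    Integrable (fun s => Real.exp (-(s * t))) (μ.restrict (Set.Ici 0)) := by
  refine Integrable.of_bound (by fun_prop) 1 ?_
  filter_upwards [ae_restrict_mem measurableSet_Ici] with s hs
  exact norm_exp_neg_mul_le_one hs ht

theorem continuousOn_laplace :
    ContinuousOn (fun t => ∫ s in Set.Ici 0, Real.exp (-(s * t)) ∂μ) (Set.Ici 0) := by
  refine continuousOn_of_dominated (bound := fun _ => 1) (fun t _ => by fun_prop) ?_
    (integrable_const _) (.of_forall fun s => by fun_prop)
  intro t ht
  filter_upwards [ae_restrict_mem measurableSet_Ici] with s hs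
  exact norm_exp_neg_mul_le_one hs ht

theorem differentiableAt_laplace {t : ℝ} (ht : 0 < t) :
    DifferentiableAt ℝ (fun t => ∫ s in Set.Ici 0, Real.exp (-(s * t)) ∂μ) t := by
  have hsub : Set.Iio 0 ⊆ ProbabilityTheory.integrableExpSet id (μ.restrict (Set.Ici 0)) := by
    intro r hr
    simpa [ProbabilityTheory.integrableExpSet, mul_comm] using
      integrable_exp_neg_mul (μ := μ) (neg_nonneg.2 (le_of_lt hr))
  have hmem : -t ∈ interior (ProbabilityTheory.integrableExpSet id (μ.restrict (Set.Ici 0))) :=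
    interior_maximal hsub isOpen_Iio (neg_lt_zero.2 ht)
  have h := (ProbabilityTheory.differentiableAt_mgf hmem).comp t differentiableAt_id.neg
  refine h.congr_of_eventuallyEq (.of_forall fun r => ?_)
  simp [ProbabilityTheory.mgf, mul_comm]

theorem sum_mul_laplace_norm_sub_sq_nonneg {ι E : Type*} [Fintype ι] [NormedAddCommGroup E]
    [InnerProductSpace ℝ E] (u : ι → E) (c : ι → ℝ) :
    0 ≤ ∑ i, ∑ j, c i * c j * ∫ s in Set.Ici 0, Real.exp (-(s * ‖u i - u j‖ ^ 2)) ∂μ := by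
  have hint (i j : ι) := (integrable_exp_neg_mul (μ := μ) (sq_nonneg ‖u i - u j‖)).const_mul
    (c i * c j)
  simp only [← integral_const_mul]
  simp_rw [← integral_finsetSum _ fun j _ => hint _ j]
  rw [← integral_finsetSum _ fun i _ => integrable_finsetSum _ fun j _ => hint i j]
  refine integral_nonneg_of_ae ?_
  filter_upwards [ae_restrict_mem measurableSet_Ici] with s hs
  exact sum_mul_exp_neg_mul_norm_sub_sq_nonneg u c hs

end Laplace

/-- Cauchy–Schwarz for evaluation differences of a kernel expansion. -/
theorem abs_sum_mul_kernel_sub_le {ι E : Type*} [Fintype ι] (k : E → E → ℝ)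
    (hsymm : ∀ x y, k x y = k y x)
    (hpos : ∀ (u : ι ⊕ Fin 2 → E) (c : ι ⊕ Fin 2 → ℝ), 0 ≤ ∑ i, ∑ j, c i * c j * k (u i) (u j))
    (u : ι → E) (c : ι → ℝ) (x y : E) :
    |∑ i, c i * (k (u i) x - k (u i) y)| ≤
      √(k x x - 2 * k x y + k y y) * √(∑ i, ∑ j, c i * c j * k (u i) (u j)) := by
  set A := ∑ i, ∑ j, c i * c j * k (u i) (u j)
  set B := ∑ i, c i * (k (u i) x - k (u i) y) with hB
  set D := k x x - 2 * k x y + k y y with hD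
  have hquad (t : ℝ) : 0 ≤ D * (t * t) + 2 * B * t + A := by
    have h := hpos (Sum.elim u ![x, y]) (Sum.elim c ![t, -t])
    simp only [Fintype.sum_sum_type, Sum.elim_inl, Sum.elim_inr, Fin.sum_univ_two,
      Matrix.cons_val_zero, Matrix.cons_val_one, Finset.sum_add_distrib] at h
    have e1 : ∑ i, c i * t * k (u i) x + ∑ i, c i * -t * k (u i) y = B * t := by
      rw [hB, Finset.sum_mul, ← Finset.sum_add_distrib]
      exact Finset.sum_congr rfl fun i _ => by ring
    have e2 : ∑ i, t * c i * k x (u i) + ∑ i, -t * c i * k y (u i) = B * t := by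
      rw [hB, Finset.sum_mul, ← Finset.sum_add_distrib]
      exact Finset.sum_congr rfl fun i _ => by rw [hsymm x, hsymm y]; ring
    have e3 := hsymm x y
    rw [← e3] at h
    calc 0 ≤ _ := h
      _ = D * (t * t) + 2 * B * t + A := by rw [hD]; linear_combination e1 + e2
  have hA : 0 ≤ A := by simpa using hquad 0
  have hdisc := discrim_le_zero hquad
  rw [discrim] at hdisc
  rw [← Real.sqrt_mul' _ hA]
  refine Real.abs_le_sqrt ?_
  nlinarith

theorem norm_sub_sq_le_of_eq_truncation {N : ℕ} {r D : ℝ} (hr : 1 < r)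
    (f g : lp (fun _ : ℕ => ℝ) 2) (hlt : ∀ n < N, f n = g n)
    (hge : ∀ n, N ≤ n → (f n - g n) ^ 2 ≤ D * (r⁻¹) ^ n) :
    ‖f - g‖ ^ 2 ≤ D * r⁻¹ ^ N * (1 - r⁻¹)⁻¹ := by
  have h := lp.hasSum_inner (𝕜 := ℝ) (f - g) (f - g)
  rw [real_inner_self_eq_norm_sq] at h
  simp only [lp.coeFn_sub, Pi.sub_apply, real_inner_self_eq_norm_sq, Real.norm_eq_abs,
    sq_abs] at h
  rw [← hasSum_nat_add_iff' N, Finset.sum_eq_zero (fun n hn => by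
    simp [hlt n (Finset.mem_range.1 hn)]), sub_zero] at h
  refine hasSum_le (fun n => ?_) h ((hasSum_geometric_of_lt_one (by positivity)
    (inv_lt_one_of_one_lt₀ hr)).mul_left (D * r⁻¹ ^ N))
  refine (hge (n + N) (Nat.le_add_left N n)).trans_eq ?_
  ring

/-- Approximation of the universal radial kernel `k(x,y) = K(‖φ x − φ y‖²)` by
its truncated version `K(‖φ x − B_t(φ_t y)‖²)`: the uniform error over `x ∈ X`
of any finite kernel expansion `∑ᵢ aᵢ k(zᵢ, ·)` is bounded by
`q^{−N}·D_X·√(2C) · √(∑_{i,j} aᵢ aⱼ k(zᵢ, zⱼ))`. -/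
theorem radial_approx_universal_truncation
    {X : Type*} [MetricSpace X] [CompactSpace X] [Nonempty X]
    (hD : 0 < Metric.diam (Set.univ : Set X))
    (x_ : ℕ → X) (hdense : ∀ (x : X) (ε : ℝ), 0 < ε → ∃ n, dist x (x_ n) ≤ ε)
    (q : ℝ) (hq : 1 < q) (N : ℕ) (hN : 2 ≤ N)
    (φ : X → lp (fun _ : ℕ => ℝ) 2)
    (hφ : ∀ (x : X) (n : ℕ),
      φ x n = Real.sqrt (q ^ 2 - 1) / q * dist x (x_ n) / q ^ n)
    (φt : X → EuclideanSpace ℝ (Fin N))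
    (hφt : ∀ (x : X) (n : Fin N),
      φt x n = Real.sqrt (q ^ 2 - 1) / q * dist x (x_ n) / q ^ (n : ℕ))
    (Bt : EuclideanSpace ℝ (Fin N) → lp (fun _ : ℕ => ℝ) 2)
    (hBt : ∀ (u : EuclideanSpace ℝ (Fin N)) (n : ℕ),
      Bt u n = if h : n < N then u ⟨n, h⟩ else 0)
    (μ : MeasureTheory.Measure ℝ) [MeasureTheory.IsFiniteMeasure μ]
    (K : ℝ → ℝ)
    (hK : ∀ t : ℝ, K t = ∫ s in Set.Ici (0 : ℝ), Real.exp (-(s * t)) ∂μ)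
    (C : ℝ)
    (hC : IsGreatest ((fun t => |deriv K t|) ''
      Set.Icc 0 (4 * Metric.diam (Set.univ : Set X) ^ 2)) C) :
    ∀ (m : ℕ) (z : Fin m → X) (c : Fin m → ℝ) (x : X),
      |∑ i, c i * (K (‖φ (z i) - φ x‖ ^ 2) -
          K (‖φ (z i) - Bt (φt x)‖ ^ 2))| ≤
        (1 / q ^ N) * Metric.diam (Set.univ : Set X) * Real.sqrt (2 * C) *
          Real.sqrt (∑ i, ∑ j, c i * c j * K (‖φ (z i) - φ (z j)‖ ^ 2)) := by
  intro m z c x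
  set R := Metric.diam (Set.univ : Set X)
  set w := Bt (φt x) with hw
  have hq0 : 0 < q := zero_lt_one.trans hq
  have hq2 : 1 < q ^ 2 := one_lt_pow₀ hq two_ne_zero
  have hKeq : K = fun t => ∫ s in Set.Ici 0, Real.exp (-(s * t)) ∂μ := funext hK
  have hC0 : 0 ≤ C := by
    obtain ⟨⟨t, _, rfl⟩, _⟩ := hC
    exact abs_nonneg _
  have hdelta : ‖φ x - w‖ ^ 2 ≤ (1 / q ^ N * R) ^ 2 := by
    have h := norm_sub_sq_le_of_eq_truncation (N := N) (D := (1 - (q ^ 2)⁻¹) * R ^ 2) hq2 (φ x) w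
      (fun n hn => by rw [hw, hBt, dif_pos hn, hφ, hφt]) (fun n hn => by
        rw [hw, hBt, dif_neg hn.not_gt, hφ, sub_zero, div_pow, mul_pow, div_pow,
          Real.sq_sqrt (by linarith)]
        have hd : dist x (x_ n) ^ 2 ≤ R ^ 2 := by
          gcongr
          exact Metric.dist_le_diam_of_mem isCompact_univ.isBounded (Set.mem_univ _)
            (Set.mem_univ _)
        have he : (q ^ 2 - 1) / q ^ 2 = 1 - (q ^ 2)⁻¹ := by field_simp
        rw [he, inv_pow, ← div_eq_mul_inv, pow_right_comm]
        have : 0 ≤ 1 - (q ^ 2)⁻¹ := sub_nonneg.2 (inv_le_one_of_one_le₀ hq2.le)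
        gcongr)
    refine h.trans_eq ?_
    have : 1 - (q ^ 2)⁻¹ ≠ 0 := (sub_pos.2 (inv_lt_one_of_one_lt₀ hq2)).ne'
    rw [mul_pow, div_pow, one_pow, inv_pow, pow_right_comm]
    rw [mul_right_comm, mul_right_comm (1 - _), mul_inv_cancel₀ this]
    ring
  have hdelta' : ‖φ x - w‖ ^ 2 ≤ 4 * R ^ 2 := by
    refine hdelta.trans ?_
    have : (1 / q ^ N) ^ 2 ≤ 1 :=
      pow_le_one₀ (by positivity) (div_le_one_of_le₀ (one_le_pow₀ hq.le) (by positivity))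
    rw [mul_pow]
    nlinarith [sq_nonneg R]
  have hmvt : K 0 - K (‖φ x - w‖ ^ 2) ≤ C * ‖φ x - w‖ ^ 2 := by
    rcases (sq_nonneg ‖φ x - w‖).eq_or_lt with h0 | h0
    · simp [← h0]
    · obtain ⟨t, ht, hslope⟩ := exists_deriv_eq_slope K h0
        (hKeq ▸ continuousOn_laplace.mono Set.Icc_subset_Ici_self)
        (fun t ht => by
          rw [hKeq]
          exact (differentiableAt_laplace ht.1).differentiableWithinAt)
      have hle : |deriv K t| ≤ C := hC.2 ⟨t, ⟨ht.1.le, ht.2.le.trans hdelta'⟩, rfl⟩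
      rw [sub_zero, eq_div_iff h0.ne'] at hslope
      nlinarith [neg_abs_le (deriv K t)]
  have hcs := abs_sum_mul_kernel_sub_le (fun f g => K (‖f - g‖ ^ 2))
    (fun f g => by rw [norm_sub_rev])
    (fun u c => by
      simp only [hK]
      exact sum_mul_laplace_norm_sub_sq_nonneg u c) (fun i => φ (z i)) c (φ x) w
  refine hcs.trans ?_
  gcongr
  refine Real.sqrt_le_iff.2 ⟨by positivity, ?_⟩
  rw [mul_pow _ √(2 * C), Real.sq_sqrt (by positivity)]
  simp only [sub_self, norm_zero, zero_pow two_ne_zero]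
  nlinarith [mul_le_mul_of_nonneg_left hdelta hC0]
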